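/- arXiv:2108.07900 — 5 statements merged into one kernel-verified Lean document; each statement's English description precedes it below -/
import Mathlib

section
/- Fix ℓ ∈ {1,…,M} and a recurrent class R_v of the chain, let π_{δ,v} denote the common value of the rows of P_δ indexed by states in R_v, and set j(q) = δ − q + 1 for q = 1,…,δ. Then there exist positive scalars η and β such that for every y ∈ X, every integer k ≥ 1 and every integer n(k) with 0 ≤ n(k) ≤ k − 1, ∑_{q=1}^δ ∑_{i,h ∈ R_v} E[(f_i(x^{δn(k)}) − f_i(y)) · 1{s_ℓ(δn(k)+1) = h, s_ℓ(δn(k)) ∈ R_v}] · [P^{δ(k−n(k)) + j(q) − 1}]_{h,i} ≥ −η e^{−β(k−n(k))} + δ ∑_{i ∈ R_v} E[(f_i(x^{δn(k)}) − f_i(y)) · 1{s_ℓ(δn(k)) ∈ R_v}] · [π_{δ,v}]_i. -/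
set_option autoImplicit false

open MeasureTheory Filter Matrix

noncomputable section

/-- Euclidean `n`-space. -/
abbrev Euc (n : ℕ) := EuclideanSpace ℝ (Fin n)

/-- The σ-algebra `G_k` generated by the initial point `x⁰`, the subgradient noises
`ε_i^t` for `1 ≤ t ≤ k`, and the Markov-chain states `s_ℓ(t)` for `t ≤ k`. -/
def historySigma {Ω : Type*} {n m M : ℕ}
    (x0 : Ω → Euc n) (ε : Fin m → ℕ → Ω → Euc n) (s : Fin M → ℕ → Ω → Fin m)
    (k : ℕ) : MeasurableSpace Ω :=
  MeasurableSpace.comap x0 inferInstance ⊔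
    (⨆ (i : Fin m) (t : ℕ) (_ : 1 ≤ t) (_ : t ≤ k), MeasurableSpace.comap (ε i t) inferInstance) ⊔
    (⨆ (ℓ : Fin M) (t : ℕ) (_ : t ≤ k), MeasurableSpace.comap (s ℓ t) inferInstance)

/-- The data and standing assumptions of the Markovian Incremental Stochastic Subgradient
Algorithm (MISSA): a probability space `(Ω, μ)`; a row-stochastic transition matrix `P` on the
`m` agents whose `δ`-step powers converge (δ being the lcm of the periods of the recurrent
classes), with Cesàro limit `Pδ`; `M` time-homogeneous Markov chains `s ℓ` with transition
matrix `P` (Markov with respect to the history σ-algebras `G_k`); noise vectors `ε`; a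
nonempty convex compact constraint set `Xset` with Euclidean projection `proj`; convex
objective summands `f i`; and a random initial point `x0 ∈ Xset`. -/
structure MISSASetup (n m M δ : ℕ) (Ω : Type) [MeasurableSpace Ω]
    (μ : Measure Ω) : Type where
  hm : 0 < m
  hM : 0 < M
  hδ : 0 < δ
  hprob : IsProbabilityMeasure μ
  P : Matrix (Fin m) (Fin m) ℝ
  hP_nonneg : ∀ i j, 0 ≤ P i j
  hP_row : ∀ i, ∑ j, P i j = 1
  Δ : Matrix (Fin m) (Fin m) ℝ
  hΔ : Tendsto (fun k : ℕ => P ^ (δ * k)) atTop (nhds Δ)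
  Pδ : Matrix (Fin m) (Fin m) ℝ
  hPδ : Tendsto (fun k : ℕ => (δ : ℝ)⁻¹ • ∑ r ∈ Finset.range δ, P ^ (k + r)) atTop (nhds Pδ)
  Xset : Set (Euc n)
  hX_nonempty : Xset.Nonempty
  hX_convex : Convex ℝ Xset
  hX_compact : IsCompact Xset
  f : Fin m → Euc n → ℝ
  hf_convex : ∀ i, ConvexOn ℝ Set.univ (f i)
  proj : Euc n → Euc n
  hproj_mem : ∀ z, proj z ∈ Xset
  hproj_dist : ∀ z, ∀ y ∈ Xset, dist (proj z) z ≤ dist y z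
  x0 : Ω → Euc n
  hx0_meas : Measurable x0
  hx0_mem : ∀ ω, x0 ω ∈ Xset
  ε : Fin m → ℕ → Ω → Euc n
  hε_meas : ∀ i k, Measurable (ε i k)
  s : Fin M → ℕ → Ω → Fin m
  hs_meas : ∀ ℓ k, Measurable (s ℓ k)
  hMarkov : ∀ (ℓ : Fin M) (k : ℕ) (i j : Fin m) (A : Set Ω),
    MeasurableSet[historySigma x0 ε s k] A →
    μ ({ω | s ℓ (k + 1) ω = j} ∩ {ω | s ℓ k ω = i} ∩ A)
      = ENNReal.ofReal (P i j) * μ ({ω | s ℓ k ω = i} ∩ A)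

namespace MISSASetup

variable {n m M δ : ℕ} {Ω : Type} [MeasurableSpace Ω] {μ : Measure Ω}

/-- The history σ-algebra `G_k` of the setup. -/
def G (S : MISSASetup n m M δ Ω μ) (k : ℕ) : MeasurableSpace Ω :=
  historySigma S.x0 S.ε S.s k

/-- The initial distribution `π_ℓ⁰` of the `ℓ`-th Markov chain. -/
def pi0 (S : MISSASetup n m M δ Ω μ) (ℓ : Fin M) : Fin m → ℝ :=
  fun i => (μ {ω | S.s ℓ 0 ω = i}).toReal

/-- The Cesàro limiting distribution `π_ℓ^∞ = P_δᵀ π_ℓ⁰` of the `ℓ`-th chain. -/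
def piInf (S : MISSASetup n m M δ Ω μ) (ℓ : Fin M) : Fin m → ℝ :=
  S.Pδ.transpose *ᵥ S.pi0 ℓ

/-- The weights `ω_i = (1/M) ∑_ℓ [π_ℓ^∞]_i`. -/
def w (S : MISSASetup n m M δ Ω μ) (i : Fin m) : ℝ :=
  (M : ℝ)⁻¹ * ∑ ℓ : Fin M, S.piInf ℓ i

/-- The weighted objective function `f = ∑_i ω_i f_i`. -/
def F (S : MISSASetup n m M δ Ω μ) (z : Euc n) : ℝ :=
  ∑ i : Fin m, S.w i * S.f i z

/-- The optimal value `f* = inf_{x ∈ X} f(x)`. -/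
def fstar (S : MISSASetup n m M δ Ω μ) : ℝ :=
  sInf (S.F '' S.Xset)

/-- The optimal set `X* = {x ∈ X : f(x) = f*}`. -/
def Xstar (S : MISSASetup n m M δ Ω μ) : Set (Euc n) :=
  {z | z ∈ S.Xset ∧ S.F z = S.fstar}

end MISSASetup

/-- A run of MISSA (Algorithm 1): positive stepsizes `lam`, subgradients `g ℓ k` of
`f_{s_ℓ(k+1)}` at `x^k`, subiterations
`x_ℓ^{k+1} = x^k − λ_k (g_{s_ℓ(k+1)}^k + ε_{s_ℓ(k+1)}^{k+1})` and iterates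
`x^{k+1} = P_X((1/M) ∑_ℓ x_ℓ^{k+1})`, started at `x⁰`. -/
structure MISSARun {n m M δ : ℕ} {Ω : Type} [MeasurableSpace Ω] {μ : Measure Ω}
    (S : MISSASetup n m M δ Ω μ) : Type where
  lam : ℕ → ℝ
  hlam_pos : ∀ k, 0 < lam k
  g : Fin M → ℕ → Ω → Euc n
  x : ℕ → Ω → Euc n
  xl : Fin M → ℕ → Ω → Euc n
  hx_meas : ∀ k, Measurable (x k)
  hx_init : ∀ ω, x 0 ω = S.x0 ω
  hg_subgrad : ∀ (ℓ : Fin M) (k : ℕ) (ω : Ω) (z : Euc n),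
    S.f (S.s ℓ (k + 1) ω) z
      ≥ S.f (S.s ℓ (k + 1) ω) (x k ω) + @inner ℝ _ _ (g ℓ k ω) (z - x k ω)
  hxl : ∀ (ℓ : Fin M) (k : ℕ) (ω : Ω),
    xl ℓ (k + 1) ω = x k ω - lam k • (g ℓ k ω + S.ε (S.s ℓ (k + 1) ω) (k + 1) ω)
  hx_rec : ∀ (k : ℕ) (ω : Ω),
    x (k + 1) ω = S.proj ((M : ℝ)⁻¹ • ∑ ℓ : Fin M, xl ℓ (k + 1) ω)

end

/-- A submultiplicative sequence of nonnegative reals tending to zero decays exponentially. -/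
theorem exists_exp_bound_of_submultiplicative {a : ℕ → ℝ} (ha : ∀ k, 0 ≤ a k)
    (hmul : ∀ j k, a (j + k) ≤ a j * a k) (hlim : Tendsto a atTop (nhds 0)) :
    ∃ C β : ℝ, 0 < C ∧ 0 < β ∧ ∀ k : ℕ, a k ≤ C * Real.exp (-β * k) := by
  obtain ⟨K, hK⟩ := hlim.bddAbove_range
  have hK' : ∀ k, a k ≤ max K 1 := fun k => le_max_of_le_left (hK ⟨k, rfl⟩)
  have hK1 : 0 < max K 1 := lt_max_of_lt_right one_pos
  obtain ⟨N, hN, hN1⟩ := ((hlim.eventually (gt_mem_nhds one_half_pos)).and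
    (eventually_ge_atTop 1)).exists
  have hNpos : (0 : ℝ) < N := by exact_mod_cast hN1
  have hlog : 0 < Real.log 2 := Real.log_pos one_lt_two
  have hexp : Real.exp (-(Real.log 2 / N) * N) = 1 / 2 := by
    rw [neg_mul, div_mul_cancel₀ _ hNpos.ne', Real.exp_neg, Real.exp_log two_pos, one_div]
  refine ⟨2 * max K 1, Real.log 2 / N, by positivity, by positivity, fun k => ?_⟩
  induction k using Nat.strong_induction_on with
  | _ k ih =>
    rcases lt_or_ge k N with hk | hk
    · have hle : (1 : ℝ) / 2 ≤ Real.exp (-(Real.log 2 / N) * k) := by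
        rw [← hexp, Real.exp_le_exp, neg_mul, neg_mul, neg_le_neg_iff]
        gcongr
      calc a k ≤ max K 1 := hK' k
        _ = 2 * max K 1 * (1 / 2) := by ring
        _ ≤ _ := by gcongr
    · obtain ⟨j, rfl⟩ := Nat.exists_eq_add_of_le hk
      calc a (N + j) ≤ a N * a j := hmul N j
        _ ≤ 1 / 2 * (2 * max K 1 * Real.exp (-(Real.log 2 / N) * j)) :=
          mul_le_mul hN.le (ih j (by omega)) (ha j) (by norm_num)
        _ = _ := by
          push_cast
          rw [mul_add, Real.exp_add, hexp]
          ring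

/-- Powers that converge in a normed ring converge exponentially fast. -/
theorem exists_exp_bound_of_tendsto_pow {A : Type*} [NormedRing A] {Q L : A}
    (h : Tendsto (fun k : ℕ => Q ^ k) atTop (nhds L)) :
    ∃ C β : ℝ, 0 < C ∧ 0 < β ∧ ∀ k : ℕ, ‖Q ^ k - L‖ ≤ C * Real.exp (-β * k) := by
  have hleft : ∀ j, Q ^ j * L = L := fun j =>
    tendsto_nhds_unique ((h.const_mul (Q ^ j)).congr fun k => by rw [← pow_add, add_comm])
      ((tendsto_add_atTop_iff_nat j).2 h)
  have hright : ∀ j, L * Q ^ j = L := fun j =>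
    tendsto_nhds_unique ((h.mul_const (Q ^ j)).congr fun k => by rw [← pow_add])
      ((tendsto_add_atTop_iff_nat j).2 h)
  have hidem : L * L = L :=
    tendsto_nhds_unique (h.mul_const L) (by simp only [hleft, tendsto_const_nhds])
  refine exists_exp_bound_of_submultiplicative (fun k => norm_nonneg _) (fun j k => ?_) ?_
  · have : Q ^ (j + k) - L = (Q ^ j - L) * (Q ^ k - L) := by
      rw [sub_mul, mul_sub, mul_sub, hleft, hright, hidem, pow_add]
      abel
    rw [this]
    exact norm_mul_le _ _
  · simpa using (h.sub_const L).norm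

section MatrixNorm

open scoped Matrix.Norms.Operator

/-- If the powers of `P ^ δ` converge and the averages of `δ` consecutive powers of `P` tend to
`L`, then the entries of the averages along multiples of `δ` converge exponentially fast. -/
theorem Matrix.exists_exp_bound_cesaro {ι : Type*} [Fintype ι] [DecidableEq ι]
    {P D L : Matrix ι ι ℝ} {δ : ℕ} (hδ : 0 < δ)
    (hD : Tendsto (fun k : ℕ => P ^ (δ * k)) atTop (nhds D))
    (hL : Tendsto (fun k : ℕ => (δ : ℝ)⁻¹ • ∑ r ∈ Finset.range δ, P ^ (k + r)) atTop (nhds L)) :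
    ∃ C β : ℝ, 0 < C ∧ 0 < β ∧ ∀ (k : ℕ) (h i : ι),
      |∑ r ∈ Finset.range δ, (P ^ (δ * k + r)) h i - δ * L h i| ≤ C * Real.exp (-β * k) := by
  have hδ' : (δ : ℝ) ≠ 0 := by exact_mod_cast hδ.ne'
  set T : Matrix ι ι ℝ := ∑ r ∈ Finset.range δ, P ^ r
  have hT : ∀ k, ∑ r ∈ Finset.range δ, P ^ (δ * k + r) = T * P ^ (δ * k) := fun k => by
    simp only [T, Finset.sum_mul, ← pow_add, add_comm]
  have hlim : (δ : ℝ)⁻¹ • (T * D) = L := by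
    refine tendsto_nhds_unique (((hD.const_mul T).const_smul (δ : ℝ)⁻¹).congr fun k => ?_)
      (hL.comp (tendsto_id.const_mul_atTop' hδ))
    simp [hT]
  have hTD : (δ : ℝ) • L = T * D := by rw [← hlim, smul_inv_smul₀ hδ']
  simp only [pow_mul] at hD
  obtain ⟨C, β, hC, hβ, hb⟩ := exists_exp_bound_of_tendsto_pow hD
  refine ⟨(‖T‖ + 1) * C, β, by positivity, hβ, fun k h i => ?_⟩
  have hentry : ∑ r ∈ Finset.range δ, (P ^ (δ * k + r)) h i - δ * L h i
      = (T * ((P ^ δ) ^ k - D)) h i := by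
    rw [mul_sub, ← hTD, ← pow_mul, ← hT, Matrix.sub_apply, Matrix.sum_apply, Matrix.smul_apply,
      smul_eq_mul]
  rw [hentry, ← Real.norm_eq_abs]
  calc ‖(T * ((P ^ δ) ^ k - D)) h i‖ ≤ ‖T * ((P ^ δ) ^ k - D)‖ := by
        rw [Matrix.linfty_opNorm_def, ← coe_nnnorm, NNReal.coe_le_coe]
        exact (Finset.single_le_sum (f := fun j => ‖(T * ((P ^ δ) ^ k - D)) h j‖₊)
          (fun _ _ => zero_le) (Finset.mem_univ i)).trans
          (Finset.le_sup (f := fun l => ∑ j, ‖(T * ((P ^ δ) ^ k - D)) l j‖₊) (Finset.mem_univ h))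
    _ ≤ ‖T‖ * ‖(P ^ δ) ^ k - D‖ := norm_mul_le _ _
    _ ≤ (‖T‖ + 1) * (C * Real.exp (-β * k)) := by
        gcongr
        · linarith
        · exact hb k
    _ = _ := by ring

end MatrixNorm

namespace MISSASetup

variable {n m M δ : ℕ} {Ω : Type} [MeasurableSpace Ω] {μ : Measure Ω}

theorem continuous_f (S : MISSASetup n m M δ Ω μ) (i : Fin m) : Continuous (S.f i) :=
  continuousOn_univ.1 ((S.hf_convex i).continuousOn isOpen_univ)

/-- The summands have uniformly bounded oscillation on the constraint set. -/
theorem exists_abs_f_sub_le (S : MISSASetup n m M δ Ω μ) :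
    ∃ B : ℝ, 0 < B ∧ ∀ i, ∀ x ∈ S.Xset, ∀ y ∈ S.Xset, |S.f i x - S.f i y| ≤ B := by
  have hb : ∀ i, ∃ K, ∀ x ∈ S.Xset, ‖S.f i x‖ ≤ K := fun i =>
    S.hX_compact.exists_bound_of_continuousOn (S.continuous_f i).continuousOn
  choose K hK using hb
  refine ⟨∑ i, 2 * |K i| + 1, by positivity, fun i x hx y hy => ?_⟩
  have h1 : 2 * |K i| ≤ ∑ i, 2 * |K i| :=
    Finset.single_le_sum (f := fun i => 2 * |K i|) (fun _ _ => by positivity) (Finset.mem_univ i)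
  have h2 := abs_sub (S.f i x) (S.f i y)
  have h3 := hK i x hx
  have h4 := hK i y hy
  rw [Real.norm_eq_abs] at h3 h4
  linarith [le_abs_self (K i)]

/-- A chain almost surely does not leave a closed class. -/
theorem ae_mem_succ_of_closed (S : MISSASetup n m M δ Ω μ) (ℓ : Fin M) {C : Finset (Fin m)}
    (hC : ∀ i ∈ C, ∀ j : Fin m, S.P i j ≠ 0 → j ∈ C) (k : ℕ) :
    ∀ᵐ ω ∂μ, S.s ℓ k ω ∈ C → S.s ℓ (k + 1) ω ∈ C := by
  have h : ∀ i ∈ C, ∀ j, j ∉ C → ∀ᵐ ω ∂μ, ¬ (S.s ℓ (k + 1) ω = j ∧ S.s ℓ k ω = i) := by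
    intro i hi j hj
    have hP : S.P i j = 0 := by
      by_contra hne
      exact hj (hC i hi j hne)
    have hμ := S.hMarkov ℓ k i j Set.univ (@MeasurableSet.univ _ (historySigma S.x0 S.ε S.s k))
    rw [hP, ENNReal.ofReal_zero, zero_mul, Set.inter_univ] at hμ
    rw [ae_iff]
    simpa [Set.ofPred_and] using hμ
  have h' : ∀ᵐ ω ∂μ, ∀ i j, i ∈ C → j ∉ C → ¬ (S.s ℓ (k + 1) ω = j ∧ S.s ℓ k ω = i) := by
    simp only [ae_all_iff]
    exact fun i j hi hj => h i hi j hj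
  filter_upwards [h'] with ω hω hk
  by_contra hk1
  exact hω _ _ hk hk1 ⟨rfl, rfl⟩

end MISSASetup

theorem MISSARun.x_mem {n m M δ : ℕ} {Ω : Type} [MeasurableSpace Ω] {μ : Measure Ω}
    {S : MISSASetup n m M δ Ω μ} (R : MISSARun S) (k : ℕ) (ω : Ω) : R.x k ω ∈ S.Xset := by
  cases k with
  | zero => rw [R.hx_init]; exact S.hx0_mem ω
  | succ k => rw [R.hx_rec]; exact S.hproj_mem _

/-- **Lemma 1.** Fix a chain `ℓ` and a recurrent class `Rv` (a nonempty closed class of states,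
on which all the rows of the Cesàro limit `P_δ` coincide with a common row `piδ`).  With
`j(q) = δ − q + 1`, there are positive scalars `η` and `β` such that for every `y ∈ X`, every
`k ≥ 1` and every `n(k)` with `0 ≤ n(k) ≤ k − 1`,
`∑_{q=1}^δ ∑_{i,h∈Rv} E[(f_i(x^{δn(k)}) − f_i(y)) 1{s_ℓ(δn(k)+1)=h, s_ℓ(δn(k))∈Rv}]
  [P^{δ(k−n(k))+j(q)−1}]_{h,i}
  ≥ −η e^{−β(k−n(k))} + δ ∑_{i∈Rv} E[(f_i(x^{δn(k)}) − f_i(y)) 1{s_ℓ(δn(k))∈Rv}] [piδ]_i`. -/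
theorem stmt_2 {n m M δ : ℕ} {Ω : Type} [MeasurableSpace Ω] {μ : MeasureTheory.Measure Ω}
    (S : MISSASetup n m M δ Ω μ) (R : MISSARun S)
    (ℓ : Fin M) (Rv : Finset (Fin m)) (hRv_ne : Rv.Nonempty)
    (hRv_closed : ∀ i ∈ Rv, ∀ j : Fin m, S.P i j ≠ 0 → j ∈ Rv)
    (piδ : Fin m → ℝ) (hRv_rows : ∀ h ∈ Rv, ∀ i, S.Pδ h i = piδ i) :
    ∃ η β : ℝ, 0 < η ∧ 0 < β ∧
      ∀ y ∈ S.Xset, ∀ k : ℕ, 1 ≤ k → ∀ nk : ℕ, nk ≤ k - 1 →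
        ∑ q ∈ Finset.Icc 1 δ, ∑ i ∈ Rv, ∑ h ∈ Rv,
            (∫ ω, (if S.s ℓ (δ * nk + 1) ω = h ∧ S.s ℓ (δ * nk) ω ∈ Rv then
                S.f i (R.x (δ * nk) ω) - S.f i y else 0) ∂μ) *
              (S.P ^ (δ * (k - nk) + (δ - q + 1) - 1)) h i
          ≥ -η * Real.exp (-β * ((k - nk : ℕ) : ℝ)) +
              δ * ∑ i ∈ Rv,
                (∫ ω, (if S.s ℓ (δ * nk) ω ∈ Rv then
                    S.f i (R.x (δ * nk) ω) - S.f i y else 0) ∂μ) * piδ i := by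
  have := S.hprob
  obtain ⟨B, hB, hosc⟩ := S.exists_abs_f_sub_le
  obtain ⟨C, β, hC, hβ, hrate⟩ := Matrix.exists_exp_bound_cesaro S.hδ S.hΔ S.hPδ
  have hcard : (0 : ℝ) < Rv.card := by exact_mod_cast hRv_ne.card_pos
  refine ⟨Rv.card * (Rv.card * (B * C)), β, by positivity, hβ, fun y hy k _ nk _ => ?_⟩
  set d := k - nk
  set I : Fin m → Fin m → ℝ := fun i h =>
    ∫ ω, (if S.s ℓ (δ * nk + 1) ω = h ∧ S.s ℓ (δ * nk) ω ∈ Rv then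
      S.f i (R.x (δ * nk) ω) - S.f i y else 0) ∂μ with hI
  have hbound : ∀ i h ω, ‖(if S.s ℓ (δ * nk + 1) ω = h ∧ S.s ℓ (δ * nk) ω ∈ Rv then
      S.f i (R.x (δ * nk) ω) - S.f i y else 0)‖ ≤ B := by
    intro i h ω
    split_ifs
    · exact hosc i _ (R.x_mem _ ω) y hy
    · simpa using hB.le
  have hint : ∀ i h, Integrable (fun ω => if S.s ℓ (δ * nk + 1) ω = h ∧ S.s ℓ (δ * nk) ω ∈ Rv then
      S.f i (R.x (δ * nk) ω) - S.f i y else 0) μ := by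
    intro i h
    refine Integrable.of_bound (Measurable.aestronglyMeasurable ?_) B (ae_of_all _ (hbound i h))
    refine Measurable.ite ?_ (((S.continuous_f i).measurable.comp (R.hx_meas _)).sub_const _)
      measurable_const
    exact (S.hs_meas ℓ _ (measurableSet_singleton h)).inter
      (S.hs_meas ℓ _ (Finset.measurableSet Rv))
  have hIle : ∀ i h, |I i h| ≤ B := fun i h => by
    simpa [hI] using norm_integral_le_of_norm_le_const (ae_of_all μ (hbound i h))
  have hsum : ∀ i, ∫ ω, (if S.s ℓ (δ * nk) ω ∈ Rv then
      S.f i (R.x (δ * nk) ω) - S.f i y else 0) ∂μ = ∑ h ∈ Rv, I i h := by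
    intro i
    rw [hI, ← integral_finsetSum _ fun h _ => hint i h]
    refine integral_congr_ae ?_
    filter_upwards [S.ae_mem_succ_of_closed ℓ hRv_closed (δ * nk)] with ω hω
    by_cases hs : S.s ℓ (δ * nk) ω ∈ Rv
    · simp [hs, hω hs]
    · simp [hs]
  have hreindex : ∀ h i, ∑ q ∈ Finset.Icc 1 δ, (S.P ^ (δ * d + (δ - q + 1) - 1)) h i
      = ∑ r ∈ Finset.range δ, (S.P ^ (δ * d + r)) h i := by
    intro h i
    refine Finset.sum_nbij' (fun q => δ - q) (fun r => δ - r) ?_ ?_ ?_ ?_ fun q _ => rfl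
    all_goals
      intro q hq
      simp only [Finset.mem_Icc, Finset.mem_range] at hq ⊢
      omega
  have hlhs : ∑ q ∈ Finset.Icc 1 δ, ∑ i ∈ Rv, ∑ h ∈ Rv,
      I i h * (S.P ^ (δ * d + (δ - q + 1) - 1)) h i
      = ∑ i ∈ Rv, ∑ h ∈ Rv, I i h * ∑ r ∈ Finset.range δ, (S.P ^ (δ * d + r)) h i := by
    rw [Finset.sum_comm]
    refine Finset.sum_congr rfl fun i _ => ?_
    rw [Finset.sum_comm]
    refine Finset.sum_congr rfl fun h _ => ?_
    rw [← Finset.mul_sum, hreindex]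
  have hrhs : (δ : ℝ) * ∑ i ∈ Rv, (∑ h ∈ Rv, I i h) * piδ i
      = ∑ i ∈ Rv, ∑ h ∈ Rv, I i h * (δ * S.Pδ h i) := by
    rw [Finset.mul_sum]
    refine Finset.sum_congr rfl fun i _ => ?_
    rw [Finset.sum_mul, Finset.mul_sum]
    refine Finset.sum_congr rfl fun h hh => ?_
    rw [hRv_rows h hh]
    ring
  have hterm : ∀ i h, -(B * C * Real.exp (-β * d)) + I i h * (δ * S.Pδ h i)
      ≤ I i h * ∑ r ∈ Finset.range δ, (S.P ^ (δ * d + r)) h i := by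
    intro i h
    have habs := mul_le_mul (hIle i h) (hrate d h i) (abs_nonneg _) hB.le
    rw [← abs_mul] at habs
    linarith [neg_abs_le (I i h *
      (∑ r ∈ Finset.range δ, (S.P ^ (δ * d + r)) h i - δ * S.Pδ h i))]
  simp only [hsum]
  rw [hrhs, ge_iff_le]
  refine le_trans (le_of_eq ?_) ((Finset.sum_le_sum fun i _ => Finset.sum_le_sum fun h _ =>
    hterm i h).trans_eq hlhs.symm)
  simp only [Finset.sum_add_distrib, Finset.sum_const, nsmul_eq_mul]
  ring
end

section
/- Let A ∈ ℝ^{m×m} and consider the linear system z_{k+1} = A z_k. If for a given initial condition z₀ ∈ ℝ^m the sequence z_k = A^k z₀ converges to zero as k → ∞, then there exist α > 0 and β > 0 such that ‖A^k z₀‖ ≤ α e^{−βk} ‖z₀‖ for all k ≥ 0. -/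
set_option autoImplicit false
open Matrix Filter

theorem ContinuousLinearMap.tendsto_zero_of_forall_apply {E F ι : Type*}
    [NormedAddCommGroup E] [NormedSpace ℝ E] [FiniteDimensional ℝ E]
    [NormedAddCommGroup F] [NormedSpace ℝ F] {l : Filter ι} {T : ι → E →L[ℝ] F}
    (hT : ∀ v, Tendsto (fun k => T k v) l (nhds 0)) : Tendsto T l (nhds 0) := by
  obtain ⟨C, hC, hbound⟩ := (Module.finBasis ℝ E).exists_opNorm_le (F := F)
  refine Metric.tendsto_nhds.2 fun ε hε => ?_
  have hsmall : ∀ᶠ k in l, ∀ i, ‖T k (Module.finBasis ℝ E i)‖ < ε / (2 * C) :=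
    eventually_all.2 fun i => by
      simpa using Metric.tendsto_nhds.1 (hT (Module.finBasis ℝ E i)) _ (by positivity)
  filter_upwards [hsmall] with k hk
  rw [dist_zero_right]
  calc ‖T k‖ ≤ C * (ε / (2 * C)) := hbound (by positivity) fun i => (hk i).le
    _ = ε / 2 := by field_simp
    _ < ε := half_lt_self hε

theorem ContinuousLinearMap.exists_norm_pow_le_exp {E : Type*}
    [NormedAddCommGroup E] [NormedSpace ℝ E] {T : E →L[ℝ] E}
    (hT : Tendsto (fun k : ℕ => T ^ k) atTop (nhds 0)) :
    ∃ α β : ℝ, 0 < α ∧ 0 < β ∧ ∀ k : ℕ, ‖T ^ k‖ ≤ α * Real.exp (-β * k) := by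
  obtain ⟨N, hN, hN0⟩ := ((Metric.tendsto_nhds.1 hT _ (Real.exp_pos (-1))).and
    (eventually_gt_atTop 0)).exists
  rw [dist_zero_right] at hN
  have hpow (q : ℕ) : ‖(T ^ N) ^ q‖ ≤ Real.exp (-q) := by
    induction q with
    | zero => simpa [ContinuousLinearMap.one_def] using ContinuousLinearMap.norm_id_le
    | succ q ih =>
      calc ‖(T ^ N) ^ (q + 1)‖ ≤ ‖(T ^ N) ^ q‖ * ‖T ^ N‖ := by
            rw [pow_succ]; exact norm_mul_le _ _
        _ ≤ Real.exp (-q) * Real.exp (-1) := by gcongr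
        _ = Real.exp (-(q + 1 : ℕ)) := by rw [← Real.exp_add]; push_cast; ring_nf
  set C := ∑ r ∈ Finset.range N, ‖T ^ r‖ with hC
  have hC0 : 0 ≤ C := Finset.sum_nonneg fun _ _ => norm_nonneg _
  have hNpos : (0 : ℝ) < N := by exact_mod_cast hN0
  refine ⟨(C + 1) * Real.exp 1, 1 / N, by positivity, by positivity, fun k => ?_⟩
  have hr : ‖T ^ (k % N)‖ ≤ C :=
    Finset.single_le_sum (f := fun r => ‖T ^ r‖) (fun _ _ => norm_nonneg _)
      (Finset.mem_range.2 (Nat.mod_lt k hN0))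
  have hexp : -((k / N : ℕ) : ℝ) ≤ 1 + -(1 / (N : ℝ)) * k := by
    have hlt : (k : ℝ) < N * ((k / N : ℕ) + 1) := by
      exact_mod_cast Nat.lt_mul_div_succ k hN0
    have hdiv : (k : ℝ) / N < (k / N : ℕ) + 1 := by
      rwa [div_lt_iff₀ hNpos, mul_comm]
    have hring : -(1 / (N : ℝ)) * k = -((k : ℝ) / N) := by ring
    linarith
  calc ‖T ^ k‖ = ‖(T ^ N) ^ (k / N) * T ^ (k % N)‖ := by
        rw [← pow_mul, ← pow_add, Nat.div_add_mod]
    _ ≤ ‖(T ^ N) ^ (k / N)‖ * ‖T ^ (k % N)‖ := norm_mul_le _ _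
    _ ≤ Real.exp (1 + -(1 / (N : ℝ)) * k) * (C + 1) := by
        gcongr
        · exact (hpow _).trans (Real.exp_le_exp.2 hexp)
        · linarith
    _ = (C + 1) * Real.exp 1 * Real.exp (-(1 / (N : ℝ)) * k) := by
        rw [Real.exp_add]; ring

/-- The vectors whose orbit under `A` converges to zero. -/
def Matrix.stableSubspace {m : ℕ} (A : Matrix (Fin m) (Fin m) ℝ) :
    Submodule ℝ (Fin m → ℝ) where
  carrier := {v | Tendsto (fun k : ℕ => A ^ k *ᵥ v) atTop (nhds 0)}
  zero_mem' := by simp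
  add_mem' {v w} hv hw := by
    simpa [Matrix.mulVec_add] using Tendsto.add hv hw
  smul_mem' c v hv := by
    simpa [Matrix.mulVec_smul] using Tendsto.const_smul hv c

theorem Matrix.mulVec_mem_stableSubspace {m : ℕ} {A : Matrix (Fin m) (Fin m) ℝ}
    {v : Fin m → ℝ} (hv : v ∈ A.stableSubspace) : A *ᵥ v ∈ A.stableSubspace := by
  change Tendsto (fun k : ℕ => A ^ k *ᵥ (A *ᵥ v)) atTop (nhds 0)
  simpa [Matrix.mulVec_mulVec, ← pow_succ, Function.comp_def] using
    Tendsto.comp (f := fun k : ℕ => k + 1) hv (tendsto_add_atTop_nat 1)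

theorem t (m : ℕ) (A : Matrix (Fin m) (Fin m) ℝ) (z0 : Fin m → ℝ)
  (h : Tendsto (fun k : ℕ => A ^ k *ᵥ z0) atTop (nhds 0)) :
  ∃ α β : ℝ, 0 < α ∧ 0 < β ∧ ∀ k : ℕ, ‖A ^ k *ᵥ z0‖ ≤ α * Real.exp (-β * k) * ‖z0‖ := by
  let T : A.stableSubspace →L[ℝ] A.stableSubspace := LinearMap.toContinuousLinearMap
    (A.mulVecLin.restrict fun _ hv => Matrix.mulVec_mem_stableSubspace hv)
  have hTpow (k : ℕ) (v : A.stableSubspace) : ((T ^ k) v : Fin m → ℝ) = A ^ k *ᵥ v := by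
    induction k generalizing v with
    | zero => simp
    | succ k ih =>
      rw [pow_succ, mul_apply_eq_comp, ih, pow_succ, ← Matrix.mulVec_mulVec]
      rfl
  have hT : Tendsto (fun k : ℕ => T ^ k) atTop (nhds 0) :=
    ContinuousLinearMap.tendsto_zero_of_forall_apply fun v => by
      rw [tendsto_subtype_rng]
      simp only [hTpow]
      exact v.2
  obtain ⟨α, β, hα, hβ, hbound⟩ := ContinuousLinearMap.exists_norm_pow_le_exp hT
  refine ⟨α, β, hα, hβ, fun k => ?_⟩
  have hk := (T ^ k).le_of_opNorm_le (hbound k) ⟨z0, h⟩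
  rwa [Submodule.coe_norm, hTpow] at hk
end

section
/- Let P be an m×m row-stochastic matrix and δ ≥ 1 an integer such that P^{δk} converges entrywise to a matrix Δ as k → ∞, and let i be a state whose limiting probability vanishes for every initial distribution, i.e. the i-th column of Δ is zero (a transient state). Then there exist ᾱ > 0 and β̄ > 0 such that for every probability vector π⁰ and every k ≥ 0, the probability that the chain started from π⁰ is in state i at time δk, namely [(Pᵀ)^{δk} π⁰]_i, satisfies [(Pᵀ)^{δk} π⁰]_i ≤ ᾱ e^{−β̄ k}. -/
set_option autoImplicit false

open Matrix Filter

/-- If the powers of an element of a normed ring tend to zero, they do so exponentially fast. -/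
theorem exists_norm_pow_le_exp_of_tendsto_zero {R : Type*} [NormedRing R] {a : R}
    (h : Tendsto (fun k : ℕ => a ^ k) atTop (nhds 0)) :
    ∃ C β : ℝ, 0 ≤ C ∧ 0 < β ∧ ∀ k : ℕ, ‖a ^ k‖ ≤ C * Real.exp (-β * k) := by
  obtain ⟨K, hK, hK1⟩ : ∃ K : ℕ, ‖a ^ K‖ < Real.exp (-1) ∧ 1 ≤ K :=
    (((tendsto_zero_iff_norm_tendsto_zero.1 h).eventually_lt_const (Real.exp_pos _)).and
      (eventually_ge_atTop 1)).exists
  have hKpos : (0 : ℝ) < K := by exact_mod_cast hK1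
  obtain ⟨B, hB⟩ := (tendsto_zero_iff_norm_tendsto_zero.1 h).bddAbove_range
  replace hB (k : ℕ) : ‖a ^ k‖ ≤ B := hB ⟨k, rfl⟩
  have hB0 : 0 ≤ B := (norm_nonneg _).trans (hB 0)
  have hblock (q r : ℕ) : ‖a ^ (K * q + r)‖ ≤ B * Real.exp (-(q : ℝ)) := by
    induction q with
    | zero => simpa using hB r
    | succ q ih =>
      have hsplit : a ^ (K * (q + 1) + r) = a ^ K * a ^ (K * q + r) := by
        rw [← pow_add]
        congr 1
        ring
      have hexp : Real.exp (-((q + 1 : ℕ) : ℝ)) = Real.exp (-1) * Real.exp (-(q : ℝ)) := by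
        rw [← Real.exp_add]
        congr 1
        push_cast
        ring
      rw [hsplit, hexp]
      calc ‖a ^ K * a ^ (K * q + r)‖ ≤ ‖a ^ K‖ * ‖a ^ (K * q + r)‖ := norm_mul_le _ _
        _ ≤ Real.exp (-1) * (B * Real.exp (-(q : ℝ))) := by gcongr
        _ = B * (Real.exp (-1) * Real.exp (-(q : ℝ))) := by ring
  refine ⟨B * Real.exp 1, 1 / K, by positivity, by positivity, fun k => ?_⟩
  have hk := hblock (k / K) (k % K)
  rw [Nat.div_add_mod] at hk
  refine hk.trans ?_
  rw [mul_assoc, ← Real.exp_add]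
  gcongr
  have hlt : (k : ℝ) < K * ((k / K : ℕ) + 1) := by
    exact_mod_cast Nat.lt_mul_div_succ k hK1
  have : (k : ℝ) / K < (k / K : ℕ) + 1 := by
    rwa [div_lt_iff₀' hKpos]
  have heq : -(1 / (K : ℝ)) * k = -((k : ℝ) / K) := by ring
  rw [heq]
  linarith

/-- If `a ^ k` converges to `b`, then `(a - b) ^ k = a ^ k - b` for every positive `k`. -/
theorem sub_pow_succ_of_tendsto_pow {R : Type*} [Ring R] [TopologicalSpace R]
    [IsTopologicalRing R] [T2Space R] {a b : R}
    (h : Tendsto (fun k : ℕ => a ^ k) atTop (nhds b)) (k : ℕ) :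
    (a - b) ^ (k + 1) = a ^ (k + 1) - b := by
  have hsucc := h.comp (tendsto_add_atTop_nat 1)
  have hba : b * a = b :=
    tendsto_nhds_unique ((h.mul_const a).congr fun k => (pow_succ a k).symm) hsucc
  have hab : a * b = b :=
    tendsto_nhds_unique ((h.const_mul a).congr fun k => (pow_succ' a k).symm) hsucc
  have hpow (k : ℕ) : a ^ k * b = b := by
    induction k with
    | zero => simp
    | succ k ih => rw [pow_succ, mul_assoc, hab, ih]
  have hbb : b * b = b :=
    tendsto_nhds_unique ((h.mul_const b).congr hpow) tendsto_const_nhds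
  induction k with
  | zero => simp
  | succ k ih =>
    rw [pow_succ, ih, mul_sub, sub_mul, sub_mul, hpow, hba, hbb, ← pow_succ]
    abel

open scoped Matrix.Norms.Operator in
/-- If the powers of a real matrix converge and a column of the limit vanishes, then the entries
of this column decay exponentially. -/
theorem exists_pow_apply_le_exp_of_tendsto {n : Type*} [Fintype n] [DecidableEq n]
    {A L : Matrix n n ℝ} (h : Tendsto (fun k : ℕ => A ^ k) atTop (nhds L)) {i : n}
    (hi : ∀ j, L j i = 0) :
    ∃ α β : ℝ, 0 < α ∧ 0 < β ∧ ∀ (k : ℕ) (j : n), (A ^ k) j i ≤ α * Real.exp (-β * k) := by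
  have hsub := sub_pow_succ_of_tendsto_pow h
  have hzero : Tendsto (fun k : ℕ => (A - L) ^ k) atTop (nhds 0) := by
    rw [← tendsto_add_atTop_iff_nat 1]
    simp only [hsub]
    simpa using (h.comp (tendsto_add_atTop_nat 1)).sub_const L
  obtain ⟨C, β, hC, hβ, hbound⟩ := exists_norm_pow_le_exp_of_tendsto_zero hzero
  refine ⟨C + 1, β, by positivity, hβ, fun k j => ?_⟩
  cases k with
  | zero =>
    have : (1 : Matrix n n ℝ) j i ≤ 1 := by
      rw [Matrix.one_apply]
      split_ifs <;> norm_num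
    simpa using this.trans (by linarith)
  | succ k =>
    have hentry (M : Matrix n n ℝ) : M j i ≤ ‖M‖ := by
      have hcol := (norm_le_pi_norm (M *ᵥ Pi.single i 1) j).trans
        (Matrix.linfty_opNorm_mulVec M _)
      rw [Matrix.mulVec_single_one, Pi.norm_single, norm_one, mul_one] at hcol
      exact (le_abs_self _).trans hcol
    have hle := (hentry _).trans (hbound (k + 1))
    rw [hsub, Matrix.sub_apply, hi, sub_zero] at hle
    refine hle.trans ?_
    gcongr
    linarith

/-- **Exponentially vanishing probability of a transient state** (Corollary, part (i)).
If `P^{δk} → Δ` entrywise and the `i`-th column of `Δ` is zero (a transient state), then the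
probability that the chain started from any initial distribution `π⁰` is in state `i` at time
`δk` is at most `ᾱ e^{-β̄ k}`, uniformly in `π⁰`. -/
theorem stmt_6 (m δ : ℕ) (hδ : 1 ≤ δ) (P : Matrix (Fin m) (Fin m) ℝ)
    (hP_nonneg : ∀ i j, 0 ≤ P i j) (hP_row : ∀ i, ∑ j, P i j = 1)
    (Δ : Matrix (Fin m) (Fin m) ℝ)
    (hconv : Tendsto (fun k : ℕ => P ^ (δ * k)) atTop (nhds Δ))
    (i : Fin m) (htransient : ∀ j, Δ j i = 0) :
    ∃ αbar βbar : ℝ, 0 < αbar ∧ 0 < βbar ∧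
      ∀ π0 : Fin m → ℝ, (∀ j, 0 ≤ π0 j) → (∑ j, π0 j = 1) →
        ∀ k : ℕ, ((P.transpose ^ (δ * k)) *ᵥ π0) i ≤ αbar * Real.exp (-βbar * k) := by
  simp only [pow_mul] at hconv
  obtain ⟨α, β, hα, hβ, hbound⟩ := exists_pow_apply_le_exp_of_tendsto hconv htransient
  refine ⟨α, β, hα, hβ, fun π0 hπ0 hsum k => ?_⟩
  rw [← Matrix.transpose_pow, pow_mul]
  calc (((P ^ δ) ^ k)ᵀ *ᵥ π0) i = ∑ j, ((P ^ δ) ^ k) j i * π0 j := rfl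
    _ ≤ ∑ j, α * Real.exp (-β * k) * π0 j :=
      Finset.sum_le_sum fun j _ => mul_le_mul_of_nonneg_right (hbound k j) (hπ0 j)
    _ = α * Real.exp (-β * k) := by rw [← Finset.mul_sum, hsum, mul_one]
end

section
/- Let P be an m×m row-stochastic matrix and δ ≥ 1 an integer such that the limit Δ = lim_{k→∞} P^{δk} exists entrywise. Then there exist α > 0 and β > 0 such that for all integers s ≥ 1 and all integers r ≥ 0, ‖P^{δs + r} − Δ P^{r}‖_∞ ≤ α e^{−βs}, where ‖·‖_∞ is the matrix norm induced by the sup-norm (maximum absolute row sum). -/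
set_option autoImplicit false

open Matrix Filter

attribute [local instance] Matrix.linftyOpNormedAddCommGroup

/-- If the powers of `A` converge to `L`, then `A * L = L`. -/
theorem mul_eq_of_tendsto_pow {m : ℕ} {A L : Matrix (Fin m) (Fin m) ℝ}
    (h : Tendsto (fun k : ℕ => A ^ k) atTop (nhds L)) : A * L = L := by
  have h1 : Tendsto (fun k : ℕ => A * A ^ k) atTop (nhds (A * L)) := h.const_mul A
  have h2 : Tendsto (fun k : ℕ => A * A ^ k) atTop (nhds L) := by
    simpa only [Function.comp_def, pow_succ'] using h.comp (tendsto_add_atTop_nat 1)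
  exact tendsto_nhds_unique h1 h2

/-- If the powers of `A` converge to `L`, then `L * A = L`. -/
theorem eq_mul_of_tendsto_pow {m : ℕ} {A L : Matrix (Fin m) (Fin m) ℝ}
    (h : Tendsto (fun k : ℕ => A ^ k) atTop (nhds L)) : L * A = L := by
  have h1 : Tendsto (fun k : ℕ => A ^ k * A) atTop (nhds (L * A)) := h.mul_const A
  have h2 : Tendsto (fun k : ℕ => A ^ k * A) atTop (nhds L) := by
    simpa only [Function.comp_def, pow_succ] using h.comp (tendsto_add_atTop_nat 1)
  exact tendsto_nhds_unique h1 h2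

/-- If the powers of `A` converge to `L`, then `A ^ k - L` is multiplicative in `k`. -/
theorem pow_add_sub_eq_mul_of_tendsto_pow {m : ℕ} {A L : Matrix (Fin m) (Fin m) ℝ}
    (h : Tendsto (fun k : ℕ => A ^ k) atTop (nhds L)) (s t : ℕ) :
    A ^ (s + t) - L = (A ^ s - L) * (A ^ t - L) := by
  have hl : ∀ k : ℕ, A ^ k * L = L := fun k => by
    induction k with
    | zero => simp
    | succ k ih => rw [pow_succ, mul_assoc, mul_eq_of_tendsto_pow h, ih]
  have hr : ∀ k : ℕ, L * A ^ k = L := fun k => by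
    induction k with
    | zero => simp
    | succ k ih => rw [pow_succ', ← mul_assoc, eq_mul_of_tendsto_pow h, ih]
  have hLL : L * L = L :=
    tendsto_nhds_unique (h.mul_const L) (by simp only [hl]; exact tendsto_const_nhds)
  rw [sub_mul, mul_sub, mul_sub, hl, hr, hLL, pow_add]
  abel

/-- Convergent powers of a matrix converge exponentially fast. -/
theorem exists_norm_pow_sub_le_exp_of_tendsto_pow {m : ℕ} {A L : Matrix (Fin m) (Fin m) ℝ}
    (h : Tendsto (fun k : ℕ => A ^ k) atTop (nhds L)) :
    ∃ α β : ℝ, 0 < α ∧ 0 < β ∧ ∀ s : ℕ, ‖A ^ s - L‖ ≤ α * Real.exp (-β * s) := by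
  have h0 : Tendsto (fun k : ℕ => ‖A ^ k - L‖) atTop (nhds 0) :=
    tendsto_iff_norm_sub_tendsto_zero.mp h
  obtain ⟨C, hC⟩ := h0.bddAbove_range
  have hC' : ∀ s, ‖A ^ s - L‖ ≤ C := fun s => hC ⟨s, rfl⟩
  have hC0 : 0 ≤ C := (norm_nonneg _).trans (hC' 0)
  obtain ⟨N, hN, hN1⟩ := ((h0.eventually (gt_mem_nhds (show (0 : ℝ) < 1 / 2 by norm_num))).and
    (eventually_ge_atTop 1)).exists
  have hNpos : (0 : ℝ) < N := by exact_mod_cast hN1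
  have hlog : 0 < Real.log 2 := Real.log_pos (by norm_num)
  have hexp : Real.exp (-(Real.log 2 / N) * N) = 1 / 2 := by
    rw [neg_mul, div_mul_cancel₀ _ hNpos.ne', Real.exp_neg, Real.exp_log two_pos, one_div]
  refine ⟨2 * C + 1, Real.log 2 / N, by positivity, by positivity, fun s => ?_⟩
  induction s using Nat.strong_induction_on with
  | _ s ih =>
    rcases lt_or_ge s N with hs | hs
    · have h1 : 1 / 2 ≤ Real.exp (-(Real.log 2 / N) * s) := by
        rw [← hexp]
        have h2 : (s : ℝ) ≤ N := by exact_mod_cast hs.le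
        exact Real.exp_le_exp.mpr (mul_le_mul_of_nonpos_left h2 (by
          have : 0 < Real.log 2 / N := by positivity
          linarith))
      have h3 := hC' s
      nlinarith
    · obtain ⟨t, rfl⟩ := Nat.exists_eq_add_of_le' hs
      have ht := ih t (by omega)
      rw [pow_add_sub_eq_mul_of_tendsto_pow h, Nat.cast_add, mul_add, Real.exp_add, hexp,
        ← mul_assoc]
      exact (linfty_opNorm_mul _ _).trans
        (mul_le_mul ht hN.le (norm_nonneg _) (by positivity))

/-- Powers of a row-stochastic matrix have sup-norm operator norm at most one. -/
theorem linfty_opNorm_pow_le_one_of_row_sum {m : ℕ} {P : Matrix (Fin m) (Fin m) ℝ}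
    (hP_nonneg : ∀ i j, 0 ≤ P i j) (hP_row : ∀ i, ∑ j, P i j = 1) (r : ℕ) : ‖P ^ r‖ ≤ 1 := by
  have hle : ∀ Q : Matrix (Fin m) (Fin m) ℝ, Q ∈ rowStochastic ℝ (Fin m) → ‖Q‖ ≤ 1 := by
    intro Q hQ
    rw [linfty_opNorm_def, NNReal.coe_le_one, Finset.sup_le_iff]
    intro i _
    rw [← NNReal.coe_le_coe]
    push_cast
    refine le_of_eq ?_
    rw [← sum_row_of_mem_rowStochastic hQ i]
    exact Finset.sum_congr rfl fun j _ => Real.norm_of_nonneg (nonneg_of_mem_rowStochastic hQ)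
  exact hle _ (pow_mem (mem_rowStochastic_iff_sum.mpr ⟨hP_nonneg, hP_row⟩) r)

/-- **Exponential convergence of shifted matrix powers** (Lemma 4 (ii)).
If `P` is row-stochastic and `P^{δk} → Δ` entrywise, then
`‖P^{δs+r} − Δ P^r‖_∞ ≤ α e^{−βs}` for all `s ≥ 1` and `r ≥ 0`, where `‖·‖_∞` is the
matrix norm induced by the sup-norm (maximum absolute row sum). -/
theorem stmt_9 (m δ : ℕ) (hδ : 1 ≤ δ) (P : Matrix (Fin m) (Fin m) ℝ)
    (hP_nonneg : ∀ i j, 0 ≤ P i j) (hP_row : ∀ i, ∑ j, P i j = 1)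
    (Δ : Matrix (Fin m) (Fin m) ℝ)
    (hconv : Tendsto (fun k : ℕ => P ^ (δ * k)) atTop (nhds Δ)) :
    ∃ α β : ℝ, 0 < α ∧ 0 < β ∧
      ∀ s : ℕ, 1 ≤ s → ∀ r : ℕ, ‖P ^ (δ * s + r) - Δ * P ^ r‖ ≤ α * Real.exp (-β * s) := by
  simp only [pow_mul] at hconv
  obtain ⟨α, β, hα, hβ, h⟩ := exists_norm_pow_sub_le_exp_of_tendsto_pow hconv
  refine ⟨α, β, hα, hβ, fun s _ r => ?_⟩
  rw [pow_add, pow_mul, ← sub_mul]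
  calc ‖((P ^ δ) ^ s - Δ) * P ^ r‖ ≤ ‖(P ^ δ) ^ s - Δ‖ * ‖P ^ r‖ := linfty_opNorm_mul _ _
    _ ≤ ‖(P ^ δ) ^ s - Δ‖ :=
        mul_le_of_le_one_right (norm_nonneg _)
          (linfty_opNorm_pow_le_one_of_row_sum hP_nonneg hP_row r)
    _ ≤ α * Real.exp (-β * s) := h s
end

section
/- Let P be an m×m row-stochastic matrix and δ ≥ 1 an integer such that the limit Δ = lim_{k→∞} P^{δk} exists entrywise. Then the Cesàro limit P̄ = lim_{k→∞} (1/k)(P⁰ + P¹ + … + P^{k−1}) exists, and it satisfies P̄ = (1/δ) lim_{k→∞} (P^k + P^{k+1} + … + P^{k+δ−1}) = (1/δ)(P⁰ + P¹ + … + P^{δ−1}) Δ. -/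
set_option autoImplicit false

open Matrix Filter

theorem tendsto_matrix_iff {ι n p : Type*} {l : Filter ι} {f : ι → Matrix n p ℝ}
    {A : Matrix n p ℝ} :
    Tendsto f l (nhds A) ↔ ∀ i j, Tendsto (fun k => f k i j) l (nhds (A i j)) :=
  tendsto_pi_nhds.trans (forall_congr' fun _ => tendsto_pi_nhds)

theorem tendsto_matrix_cesaro {n p : Type*} {f : ℕ → Matrix n p ℝ} {A : Matrix n p ℝ}
    (h : Tendsto f atTop (nhds A)) :
    Tendsto (fun k : ℕ => (k : ℝ)⁻¹ • ∑ r ∈ Finset.range k, f r) atTop (nhds A) := by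
  rw [tendsto_matrix_iff] at h ⊢
  intro i j
  simpa [Matrix.sum_apply] using (h i j).cesaro

theorem tendsto_inv_smul_pow_of_mem_rowStochastic {n : Type*} [Fintype n] [DecidableEq n]
    {P : Matrix n n ℝ} (hP : P ∈ rowStochastic ℝ n) :
    Tendsto (fun k : ℕ => (k : ℝ)⁻¹ • P ^ k) atTop (nhds 0) := by
  rw [tendsto_matrix_iff]
  intro i j
  have hk (k : ℕ) : P ^ k ∈ rowStochastic ℝ n := pow_mem hP k
  refine squeeze_zero (fun k => ?_) (fun k => ?_) (tendsto_inv_atTop_nhds_zero_nat (𝕜 := ℝ))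
  · exact mul_nonneg (by positivity) (nonneg_of_mem_rowStochastic (hk k))
  · exact mul_le_of_le_one_right (by positivity) (le_one_of_mem_rowStochastic (hk k))

/-- If `P^{δk}` converges to `Δ`, then `(P⁰ + … + P^{δ-1}) * P^k` converges along all `k`, not only
along the multiples of `δ`. -/
theorem tendsto_geom_sum_mul_pow {n : Type*} [Fintype n] [DecidableEq n]
    {P Δ : Matrix n n ℝ} {δ : ℕ} (hδ : 0 < δ)
    (h : Tendsto (fun k : ℕ => P ^ (δ * k)) atTop (nhds Δ)) :
    Tendsto (fun k : ℕ => (∑ r ∈ Finset.range δ, P ^ r) * P ^ k) atTop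
      (nhds ((∑ r ∈ Finset.range δ, P ^ r) * Δ)) := by
  set S := ∑ r ∈ Finset.range δ, P ^ r with hS
  have hΔ : P ^ δ * Δ = Δ := by
    refine tendsto_nhds_unique ?_ ((tendsto_add_atTop_iff_nat 1).2 h)
    refine (h.const_mul (P ^ δ)).congr fun k => ?_
    rw [← pow_add, mul_add, mul_one, add_comm]
  have hfix : P * (S * Δ) = S * Δ := by
    have := mul_geom_sum P δ
    rw [← sub_eq_zero, ← mul_assoc, ← sub_mul, ← sub_one_mul, hS, this, sub_mul, hΔ, one_mul,
      sub_self]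
  have hfix_pow (t : ℕ) : P ^ t * (S * Δ) = S * Δ := by
    induction t with
    | zero => simp
    | succ t ih => rw [pow_succ, mul_assoc, hfix, ih]
  have hdiv : Tendsto (fun k : ℕ => k / δ) atTop atTop := Nat.tendsto_div_const_atTop hδ.ne'
  have hlim (t : ℕ) : Tendsto (fun k : ℕ => P ^ t * (S * P ^ (δ * (k / δ)))) atTop
      (nhds (S * Δ)) := by
    simpa only [hfix_pow, Function.comp_apply] using ((h.comp hdiv).const_mul S).const_mul (P ^ t)
  have hcomm (t : ℕ) : Commute (P ^ t) S :=
    Commute.sum_right _ _ _ fun r _ => Commute.pow_pow_self P t r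
  intro U hU
  have hev : ∀ᶠ k : ℕ in atTop, ∀ t ∈ Finset.range δ, P ^ t * (S * P ^ (δ * (k / δ))) ∈ U :=
    (Finset.eventually_all _).2 fun t _ => hlim t hU
  rw [mem_map]
  filter_upwards [hev] with k hk
  rw [Set.mem_preimage]
  have := hk (k % δ) (Finset.mem_range.2 (Nat.mod_lt k hδ))
  rwa [← mul_assoc, (hcomm _).eq, mul_assoc, ← pow_add, Nat.mod_add_div] at this

/-- **Existence and identification of the Cesàro limit of the powers of `P`.**
If `P` is row-stochastic and `Δ = lim_k P^{δk}` exists entrywise, then the Cesàro limit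
`P̄ = lim_k (1/k)(P⁰ + … + P^{k−1})` exists and equals both
`(1/δ) lim_k (P^k + … + P^{k+δ−1})` and `(1/δ)(P⁰ + … + P^{δ−1}) Δ`. -/
theorem stmt_10 (m δ : ℕ) (hδ : 1 ≤ δ) (P : Matrix (Fin m) (Fin m) ℝ)
    (hP_nonneg : ∀ i j, 0 ≤ P i j) (hP_row : ∀ i, ∑ j, P i j = 1)
    (Δ : Matrix (Fin m) (Fin m) ℝ)
    (hconv : Tendsto (fun k : ℕ => P ^ (δ * k)) atTop (nhds Δ)) :
    Tendsto (fun k : ℕ => (k : ℝ)⁻¹ • ∑ r ∈ Finset.range k, P ^ r) atTop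
        (nhds ((δ : ℝ)⁻¹ • ((∑ r ∈ Finset.range δ, P ^ r) * Δ))) ∧
      Tendsto (fun k : ℕ => (δ : ℝ)⁻¹ • ∑ r ∈ Finset.range δ, P ^ (k + r)) atTop
        (nhds ((δ : ℝ)⁻¹ • ((∑ r ∈ Finset.range δ, P ^ r) * Δ))) := by
  have hP : P ∈ rowStochastic ℝ (Fin m) := mem_rowStochastic_iff_sum.2 ⟨hP_nonneg, hP_row⟩
  have hS := tendsto_geom_sum_mul_pow hδ hconv
  have hδ' : (δ : ℝ) ≠ 0 := by positivity
  set S := ∑ r ∈ Finset.range δ, P ^ r with hS_def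
  refine ⟨?_, ?_⟩
  · have hmean := tendsto_matrix_cesaro hS
    have hdiff : Tendsto (fun k : ℕ => (k : ℝ)⁻¹ • (1 - P ^ k)) atTop (nhds 0) := by
      simpa [smul_sub] using ((tendsto_inv_atTop_nhds_zero_nat (𝕜 := ℝ)).smul_const
        (1 : Matrix (Fin m) (Fin m) ℝ)).sub (tendsto_inv_smul_pow_of_mem_rowStochastic hP)
    have hsum : (1 - P) * ∑ r ∈ Finset.range δ, ∑ j ∈ Finset.range r, P ^ j = (δ : ℝ) • 1 - S := by
      rw [Finset.mul_sum]
      simp only [mul_neg_geom_sum, Finset.sum_sub_distrib, Finset.sum_const, Finset.card_range,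
        ← Nat.cast_smul_eq_nsmul ℝ, hS_def]
    set T := ∑ r ∈ Finset.range δ, ∑ j ∈ Finset.range r, P ^ j
    have key := (hmean.add (hdiff.mul_const T)).const_smul (δ : ℝ)⁻¹
    rw [zero_mul, add_zero] at key
    refine key.congr fun k => ?_
    have hcomm : Commute S (∑ r ∈ Finset.range k, P ^ r) :=
      Commute.sum_left _ _ _ fun i _ => Commute.sum_right _ _ _ fun j _ => Commute.pow_pow_self P i j
    rw [← Finset.mul_sum, hcomm.eq, ← geom_sum_mul_neg, smul_mul_assoc, mul_assoc, hsum,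
      ← smul_add, ← mul_add, add_sub_cancel, mul_smul_comm, mul_one, smul_comm,
      inv_smul_smul₀ hδ']
  · refine (hS.const_smul (δ : ℝ)⁻¹).congr fun k => ?_
    simp only [hS_def, Finset.sum_mul, ← pow_add, add_comm]
end
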